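/- Let A : V → W be a linear map between finite-dimensional real inner product spaces and let k ≥ 1 be an integer. Then the operator norm of the induced map Λ^{k+1}A on (k+1)-st exterior powers satisfies ‖Λ^{k+1}A‖ ≤ ‖Λ^k A‖^{(k+1)/k}, where exterior powers carry the inner products induced from V and W. -/

import Mathlib

/-!
Basic notions: the unit sphere `S^{d-1} ⊆ ℝ^d`, the norm `‖Λ^k A‖` of the induced map on
`k`-th exterior powers of a linear map between inner product spaces, and the `k`-dilation of a
`C¹` map between unit spheres.  A (`C¹`) map from `S^{d₁-1}` to `S^{d₂-1}` is represented by a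
(`C¹`) ambient map `F : ℝ^{d₁} → ℝ^{d₂}` mapping the unit sphere into the unit sphere; its
`k`-dilation only depends on the restriction of `F` to the sphere, since the derivative is
restricted to the tangent space of the sphere.
-/

open scoped RealInnerProductSpace
open Set

noncomputable section

abbrev EucA (d : ℕ) := EuclideanSpace ℝ (Fin d)

/-- The unit sphere `S^{d-1}` in `ℝ^d` (with the round metric induced from `ℝ^d`). -/
def usph (d : ℕ) : Set (EucA d) := Metric.sphere 0 1

/-- The operator norm `‖Λ^k A‖` of the induced map on `k`-th exterior powers (with their induced
inner products): the supremum, over orthonormal `k`-frames `v` of the domain, of the `k`-volume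
`√ det (⟪A vᵢ, A vⱼ⟫)` of the image frame `A v₁, …, A v_k`. -/
noncomputable def lamNorm {E F : Type*} [NormedAddCommGroup E] [InnerProductSpace ℝ E]
    [NormedAddCommGroup F] [InnerProductSpace ℝ F] (k : ℕ) (A : E →ₗ[ℝ] F) : ℝ :=
  ⨆ v : {v : Fin k → E // Orthonormal ℝ v},
    Real.sqrt (Matrix.of fun (i j : Fin k) => ⟪A (v.1 i), A (v.1 j)⟫).det

/-- The `k`-dilation of a map of the unit sphere `S^{d-1}` into an inner product space (e.g. into
`ℝ^{d₂}`, for a map to the sphere `S^{d₂-1}`), the map being given by an ambient map `F`: the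
supremum over points `x` of the sphere of `‖Λ^k df_x‖`, where `df_x` is the derivative of `F` at
`x` restricted to the tangent space `(ℝ∙x)ᗮ` of the sphere at `x`. -/
noncomputable def kDilation {d : ℕ} {F' : Type*} [NormedAddCommGroup F']
    [InnerProductSpace ℝ F'] (k : ℕ) (F : EucA d → F') : ℝ :=
  ⨆ x : usph d,
    lamNorm k ((fderiv ℝ F (x : EucA d)).toLinearMap ∘ₗ ((ℝ ∙ (x : EucA d))ᗮ).subtype)

section ExteriorPowerNorm

variable {E F : Type*} [NormedAddCommGroup E] [InnerProductSpace ℝ E]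
  [NormedAddCommGroup F] [InnerProductSpace ℝ F]

theorem lamNorm_nonneg (k : ℕ) (A : E →ₗ[ℝ] F) : 0 ≤ lamNorm k A :=
  Real.iSup_nonneg fun _ => Real.sqrt_nonneg _

theorem bddAbove_sqrt_det_gram [FiniteDimensional ℝ E] (k : ℕ) (A : E →ₗ[ℝ] F) :
    BddAbove (Set.range fun v : {v : Fin k → E // Orthonormal ℝ v} =>
      Real.sqrt (Matrix.of fun (i j : Fin k) => ⟪A (v.1 i), A (v.1 j)⟫).det) := by
  set C : ℝ := ‖LinearMap.toContinuousLinearMap A‖ with hC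
  refine ⟨Real.sqrt (k.factorial • (C * C) ^ k), ?_⟩
  rintro _ ⟨v, rfl⟩
  have hA (i : Fin k) : ‖A (v.1 i)‖ ≤ C := by
    simpa [v.2.1 i] using (LinearMap.toContinuousLinearMap A).le_opNorm (v.1 i)
  refine Real.sqrt_le_sqrt ((le_abs_self _).trans ?_)
  have hdet := Matrix.det_le (A := Matrix.of fun (i j : Fin k) => ⟪A (v.1 i), A (v.1 j)⟫)
    (abv := AbsoluteValue.abs) (x := C * C) fun i j =>
      (abs_real_inner_le_norm _ _).trans
        (mul_le_mul (hA i) (hA j) (norm_nonneg _) (norm_nonneg _))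
  simpa using hdet

theorem sqrt_det_gram_le_lamNorm [FiniteDimensional ℝ E] {k : ℕ} (A : E →ₗ[ℝ] F)
    {v : Fin k → E} (hv : Orthonormal ℝ v) :
    Real.sqrt (Matrix.of fun (i j : Fin k) => ⟪A (v i), A (v j)⟫).det ≤ lamNorm k A :=
  le_ciSup (bddAbove_sqrt_det_gram k A) ⟨v, hv⟩

theorem sqrt_det_gram_of_pairwise_orthogonal {ι : Type*} [Fintype ι] [DecidableEq ι] {f : ι → F}
    (hf : Pairwise fun i j => ⟪f i, f j⟫ = 0) :
    Real.sqrt (Matrix.of fun i j => ⟪f i, f j⟫).det = ∏ i, ‖f i‖ := by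
  have hdiag : (Matrix.of fun i j => ⟪f i, f j⟫) = Matrix.diagonal fun i => ‖f i‖ ^ 2 := by
    ext i j
    by_cases hij : i = j
    · subst hij
      simp
    · simp [hij, hf hij]
  rw [hdiag, Matrix.det_diagonal, Finset.prod_pow,
    Real.sqrt_sq (Finset.prod_nonneg fun _ _ => norm_nonneg _)]

theorem gram_sum_smul {ι : Type*} [Fintype ι] (U : Matrix ι ι ℝ) (f : ι → F) :
    (Matrix.of fun i j => ⟪∑ a, U a i • f a, ∑ b, U b j • f b⟫) =
      U.transpose * (Matrix.of fun i j => ⟪f i, f j⟫) * U := by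
  ext i j
  simp only [Matrix.of_apply, Matrix.mul_apply, Matrix.transpose_apply, sum_inner, inner_sum,
    real_inner_smul_left, real_inner_smul_right, Finset.sum_mul]
  refine Finset.sum_congr rfl fun b _ => Finset.sum_congr rfl fun a _ => ?_
  ring

/-- A singular value decomposition on the span of an orthonormal family: the family can be rotated
so that its image under `A` becomes orthogonal, without changing the Gram determinant. -/
theorem exists_orthonormal_image_orthogonal {ι : Type*} [Fintype ι] [DecidableEq ι]
    (A : E →ₗ[ℝ] F) {v : ι → E} (hv : Orthonormal ℝ v) :
    ∃ w : ι → E, Orthonormal ℝ w ∧ (Pairwise fun i j => ⟪A (w i), A (w j)⟫ = 0) ∧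
      (Matrix.of fun i j => ⟪A (w i), A (w j)⟫).det =
        (Matrix.of fun i j => ⟪A (v i), A (v j)⟫).det := by
  set M : Matrix ι ι ℝ := Matrix.of fun i j => ⟪A (v i), A (v j)⟫ with hM
  have hMh : M.IsHermitian := by
    ext i j
    simp [hM, real_inner_comm]
  set U : Matrix ι ι ℝ := hMh.eigenvectorUnitary.1 with hU
  have hUU : U.transpose * U = 1 := by
    simpa [Matrix.star_eq_conjTranspose] using
      Unitary.coe_star_mul_self hMh.eigenvectorUnitary
  have hdiag : U.transpose * M * U = Matrix.diagonal hMh.eigenvalues := by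
    have h := hMh.spectral_theorem
    rw [Unitary.conjStarAlgAut_apply] at h
    have hU' : (star hMh.eigenvectorUnitary : Matrix ι ι ℝ) = U.transpose := by
      simp [hU, Matrix.star_eq_conjTranspose]
    rw [hU', ← hU] at h
    conv_lhs => rw [h]
    calc U.transpose * (U * Matrix.diagonal (RCLike.ofReal ∘ hMh.eigenvalues) * U.transpose) * U
        = (U.transpose * U) * Matrix.diagonal (RCLike.ofReal ∘ hMh.eigenvalues) *
            (U.transpose * U) := by simp only [Matrix.mul_assoc]
      _ = _ := by
        rw [hUU, Matrix.one_mul, Matrix.mul_one]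
        rfl
  have hAw : (Matrix.of fun i j => ⟪A (∑ a, U a i • v a), A (∑ b, U b j • v b)⟫) =
      U.transpose * M * U := by
    simp only [map_sum, map_smul]
    exact gram_sum_smul U fun i => A (v i)
  refine ⟨fun i => ∑ a, U a i • v a, ?_, fun i j hij => ?_, ?_⟩
  · have hvv : (Matrix.of fun i j => ⟪v i, v j⟫) = (1 : Matrix ι ι ℝ) := by
      ext i j
      simp [orthonormal_iff_ite.mp hv i j, Matrix.one_apply]
    have hww := gram_sum_smul U v
    rw [hvv, Matrix.mul_one, hUU] at hww
    refine orthonormal_iff_ite.mpr fun i j => ?_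
    simpa [Matrix.one_apply] using congrFun (congrFun hww i) j
  · have h := congrFun (congrFun (hAw.trans hdiag) i) j
    rwa [Matrix.diagonal_apply_ne _ hij] at h
  · have hdetU : U.transpose.det * U.det = 1 := by rw [← Matrix.det_mul, hUU, Matrix.det_one]
    rw [hAw, Matrix.det_mul, Matrix.det_mul, mul_right_comm, hdetU, one_mul]

end ExteriorPowerNorm

theorem prod_pow_le_of_prod_succAbove_le {k : ℕ} {s : Fin (k + 1) → ℝ} {L : ℝ}
    (hs : ∀ i, 0 ≤ s i) (hL : ∀ i : Fin (k + 1), ∏ j, s (i.succAbove j) ≤ L) :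
    (∏ i, s i) ^ k ≤ L ^ (k + 1) := by
  have hP : 0 ≤ ∏ i, s i := Finset.prod_nonneg fun i _ => hs i
  have hQ (i : Fin (k + 1)) : 0 ≤ ∏ j, s (i.succAbove j) := Finset.prod_nonneg fun j _ => hs _
  rcases hP.eq_or_lt with h0 | hpos
  · rcases Nat.eq_zero_or_pos k with rfl | hk
    · simpa using hL 0
    · rw [← h0, zero_pow hk.ne']
      exact pow_nonneg ((hQ 0).trans (hL 0)) _
  · have hprod : ∏ i : Fin (k + 1), ∏ j, s (i.succAbove j) = (∏ i, s i) ^ k := by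
      refine mul_left_cancel₀ hpos.ne' ?_
      rw [← Finset.prod_mul_distrib, ← pow_succ']
      simp [← Fin.prod_univ_succAbove]
    rw [← hprod]
    simpa using Finset.prod_le_prod (fun i _ => hQ i) fun i (_ : i ∈ Finset.univ) => hL i

/-- Let `A : V → W` be a linear map between finite-dimensional real inner product spaces and
`k ≥ 1`.  Then the operator norm of the induced map on `(k+1)`-st exterior powers (with the
induced inner products) satisfies `‖Λ^{k+1} A‖ ≤ ‖Λ^k A‖^{(k+1)/k}` (a real power). -/
theorem lamNorm_succ_le {V W : Type*}
    [NormedAddCommGroup V] [InnerProductSpace ℝ V] [FiniteDimensional ℝ V]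
    [NormedAddCommGroup W] [InnerProductSpace ℝ W] [FiniteDimensional ℝ W]
    (A : V →ₗ[ℝ] W) (k : ℕ) (hk : 1 ≤ k) :
    lamNorm (k + 1) A ≤ lamNorm k A ^ (((k : ℝ) + 1) / (k : ℝ)) := by
  have hL := lamNorm_nonneg k A
  refine Real.iSup_le (fun ⟨v, hv⟩ => ?_) (Real.rpow_nonneg hL _)
  obtain ⟨w, hw, horth, hdet⟩ := exists_orthonormal_image_orthogonal A hv
  rw [← hdet, sqrt_det_gram_of_pairwise_orthogonal horth]
  have hpow : (∏ i, ‖A (w i)‖) ^ k ≤ lamNorm k A ^ (k + 1) := by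
    refine prod_pow_le_of_prod_succAbove_le (fun _ => norm_nonneg _) fun i => ?_
    have hinj : Function.Injective i.succAbove := Fin.succAbove_right_injective
    rw [← sqrt_det_gram_of_pairwise_orthogonal (f := fun j => A (w (i.succAbove j)))
      fun a b hab => horth (hinj.ne hab)]
    exact sqrt_det_gram_le_lamNorm A (hw.comp _ hinj)
  have hk0 : k ≠ 0 := Nat.one_le_iff_ne_zero.mp hk
  refine le_of_pow_le_pow_left₀ hk0 (Real.rpow_nonneg hL _) (hpow.trans_eq ?_)
  rw [← Real.rpow_mul_natCast hL, div_mul_cancel₀ _ (Nat.cast_ne_zero.mpr hk0)]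
  exact_mod_cast (Real.rpow_natCast _ (k + 1)).symm
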